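/- (Li–Yau-type gradient estimate for the first Dirichlet eigenfunction) Let n ≥ 1, let Ω ⊂ ℝⁿ be a nonempty bounded open convex set with smooth boundary, let F be a strongly convex Minkowski norm of class C³ on ℝⁿ∖{0}, and let λ > 0. Let u ∈ C¹(closure(Ω)) be C² on {x ∈ Ω : ∇u(x) ≠ 0}, with u > 0 in Ω, u = 0 on ∂Ω, sup_Ω u = 1, and Σ_{i,j} a_{ij}(∇u(x)) u_{ij}(x) = −λ u(x) at every x ∈ Ω where ∇u(x) ≠ 0. Then for every α > 0 and every x ∈ closure(Ω): F(∇u(x))² ≤ λ ( (α+1)² − (α + u(x))² ). In particular, letting α → 0, F(∇u)² ≤ λ(1 − u²) on closure(Ω). -/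

import Mathlib

open Real
open scoped RealInnerProductSpace

noncomputable section

/-- The `i`-th partial derivative of `f : ℝⁿ → ℝ` at `x`. -/
def pd {n : ℕ} (f : EuclideanSpace ℝ (Fin n) → ℝ) (i : Fin n)
    (x : EuclideanSpace ℝ (Fin n)) : ℝ :=
  fderiv ℝ f x (EuclideanSpace.single i 1)

/-- `a_{ij}(ξ) = ∂²(½F²)/∂ξ_i∂ξ_j (ξ)`. -/
def aCoeff {n : ℕ} (F : EuclideanSpace ℝ (Fin n) → ℝ) (i j : Fin n)
    (ξ : EuclideanSpace ℝ (Fin n)) : ℝ :=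
  pd (pd (fun η => F η ^ 2 / 2) i) j ξ

/-- A Minkowski norm on ℝⁿ: nonnegative, convex, even, positively 1-homogeneous,
and positive away from the origin. -/
structure IsMinkowskiNorm {n : ℕ} (F : EuclideanSpace ℝ (Fin n) → ℝ) : Prop where
  nonneg : ∀ ξ, 0 ≤ F ξ
  convexOn : ConvexOn ℝ Set.univ F
  even : ∀ ξ, F (-ξ) = F ξ
  homog : ∀ (t : ℝ) (ξ : EuclideanSpace ℝ (Fin n)), F (t • ξ) = |t| * F ξ
  pos : ∀ ξ, ξ ≠ 0 → 0 < F ξ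

/-- A strongly convex Minkowski norm of class C³: additionally `F` is C³ away from
the origin and the Hessian of `F²` is positive definite away from the origin. -/
structure IsStronglyConvexMinkowskiNormC3 {n : ℕ}
    (F : EuclideanSpace ℝ (Fin n) → ℝ) extends IsMinkowskiNorm F : Prop where
  contDiff3 : ContDiffOn ℝ 3 F {(0 : EuclideanSpace ℝ (Fin n))}ᶜ
  posDef : ∀ ξ : EuclideanSpace ℝ (Fin n), ξ ≠ 0 →
    ∀ V : EuclideanSpace ℝ (Fin n), V ≠ 0 →
      0 < ∑ i, ∑ j, aCoeff F i j ξ * V i * V j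

/-- A set has smooth boundary: near each boundary point there is a smooth local defining
function with nonvanishing differential. -/
def HasSmoothBoundary {n : ℕ} (Ω : Set (EuclideanSpace ℝ (Fin n))) : Prop :=
  ∀ x ∈ frontier Ω, ∃ U ∈ nhds x, ∃ f : EuclideanSpace ℝ (Fin n) → ℝ,
    ContDiff ℝ (⊤ : ℕ∞) f ∧ (∀ y ∈ U, (y ∈ Ω ↔ f y < 0)) ∧
      ∀ y ∈ U, y ∈ frontier Ω → fderiv ℝ f y ≠ 0

open Filter Topology Set

/-- A function with a one-sided maximum has nonpositive derivative there. -/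
lemma HasDerivAt.nonpos_of_eventually_right_le {g : ℝ → ℝ} {c : ℝ} (h : HasDerivAt g c 0)
    (hle : ∀ᶠ t in 𝓝[>] (0 : ℝ), g t ≤ g 0) : c ≤ 0 := by
  refine le_of_tendsto h.tendsto_slope_zero_right ?_
  filter_upwards [hle, self_mem_nhdsWithin] with t ht ht0
  have h0 : (0 : ℝ) < t := ht0
  simp only [zero_add, smul_eq_mul]
  exact mul_nonpos_of_nonneg_of_nonpos (by positivity) (by linarith)

/-- The necessary second-order condition at a local maximum. -/
lemma IsLocalMax.second_deriv_nonpos {e e₁ : ℝ → ℝ} {c : ℝ} (hmax : IsLocalMax e 0)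
    (h₁ : ∀ᶠ t in 𝓝 (0 : ℝ), HasDerivAt e (e₁ t) t) (h₂ : HasDerivAt e₁ c 0) : c ≤ 0 := by
  have hd : deriv e =ᶠ[𝓝 0] e₁ := h₁.mono fun t ht => ht.deriv
  have hdd : deriv (deriv e) 0 = c := by rw [hd.deriv_eq, h₂.deriv]
  by_contra hc
  have hmin : IsLocalMin e 0 :=
    isLocalMin_of_deriv_deriv_pos (by rw [hdd]; linarith) hmax.deriv_eq_zero
      h₁.self_of_nhds.continuousAt
  have hconst : e =ᶠ[𝓝 0] fun _ => e 0 := by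
    filter_upwards [hmax, hmin] with t h h' using le_antisymm h h'
  have : deriv (deriv e) 0 = 0 := by
    rw [hconst.deriv.deriv_eq]; simp
  linarith

lemma EuclideanSpace.sum_smul_single {n : ℕ} (w : EuclideanSpace ℝ (Fin n)) :
    ∑ i, w i • EuclideanSpace.single i (1 : ℝ) = w := by
  simpa using (EuclideanSpace.basisFun (Fin n) ℝ).sum_repr w

lemma pd_pd_eq {n : ℕ} {f : EuclideanSpace ℝ (Fin n) → ℝ} {x : EuclideanSpace ℝ (Fin n)}
    (hf : DifferentiableAt ℝ (fderiv ℝ f) x) (i j : Fin n) :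
    pd (pd f i) j x =
      fderiv ℝ (fderiv ℝ f) x (EuclideanSpace.single j 1) (EuclideanSpace.single i 1) := by
  change fderiv ℝ (fun y => fderiv ℝ f y (EuclideanSpace.single i 1)) x _ = _
  rw [fderiv_clm_apply hf (differentiableAt_const _)]
  simp

lemma sum_pd_pd_eq {n : ℕ} {f : EuclideanSpace ℝ (Fin n) → ℝ} {x : EuclideanSpace ℝ (Fin n)}
    (hf : DifferentiableAt ℝ (fderiv ℝ f) x) (w : EuclideanSpace ℝ (Fin n)) :
    ∑ i, ∑ j, pd (pd f i) j x * w i * w j = fderiv ℝ (fderiv ℝ f) x w w := by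
  conv_rhs => rw [← EuclideanSpace.sum_smul_single w]
  simp only [map_sum, map_smul, sum_apply, smul_apply,
    smul_eq_mul, Finset.mul_sum, pd_pd_eq hf]
  refine Finset.sum_congr rfl fun i _ => Finset.sum_congr rfl fun j _ => ?_
  ring

lemma ContDiffAt.differentiableAt_fderiv_of_two {E : Type*} [NormedAddCommGroup E]
    [NormedSpace ℝ E] {f : E → ℝ} {x : E} (hf : ContDiffAt ℝ 2 f x) :
    DifferentiableAt ℝ (fderiv ℝ f) x :=
  (hf.fderiv_right (m := 1) (by norm_num)).differentiableAt (by norm_num)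

lemma fderiv_apply_self_of_homog {E : Type*} [NormedAddCommGroup E] [NormedSpace ℝ E]
    {H : Type*} [NormedAddCommGroup H] [NormedSpace ℝ H]
    {f : E → H} {ξ : E} (hf : DifferentiableAt ℝ f ξ) {k : ℕ}
    (hh : ∀ c : ℝ, 0 < c → f (c • ξ) = c ^ k • f ξ) : fderiv ℝ f ξ ξ = (k : ℝ) • f ξ := by
  have h1 : HasDerivAt (fun c : ℝ => f (c • ξ)) (fderiv ℝ f ξ ξ) 1 := by
    have h2 : HasDerivAt (fun c : ℝ => c • ξ) ξ 1 := by
      simpa using (hasDerivAt_id (1 : ℝ)).smul_const ξ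
    have h3 : HasFDerivAt f (fderiv ℝ f ξ) ((1 : ℝ) • ξ) := by simpa using hf.hasFDerivAt
    exact h3.comp_hasDerivAt (1 : ℝ) h2
  have h4 : HasDerivAt (fun c : ℝ => c ^ k • f ξ) ((k : ℝ) • f ξ) 1 := by
    simpa using (hasDerivAt_pow k (1 : ℝ)).smul_const (f ξ)
  refine h1.unique (h4.congr_of_eventuallyEq ?_)
  filter_upwards [lt_mem_nhds (zero_lt_one' ℝ)] with c hc using hh c hc

namespace IsMinkowskiNorm

variable {n : ℕ} {F : EuclideanSpace ℝ (Fin n) → ℝ}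

lemma map_zero (hF : IsMinkowskiNorm F) : F 0 = 0 := by simpa using hF.homog 0 0

lemma add_le (hF : IsMinkowskiNorm F) (ξ η : EuclideanSpace ℝ (Fin n)) :
    F (ξ + η) ≤ F ξ + F η := by
  have h := hF.convexOn.2 (mem_univ ξ) (mem_univ η)
    (by norm_num : (0 : ℝ) ≤ 1 / 2) (by norm_num : (0 : ℝ) ≤ 1 / 2) (by norm_num)
  have h2 := hF.homog 2 ((1 / 2 : ℝ) • ξ + (1 / 2 : ℝ) • η)
  have h3 : (2 : ℝ) • ((1 / 2 : ℝ) • ξ + (1 / 2 : ℝ) • η) = ξ + η := by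
    rw [smul_add, smul_smul, smul_smul]; norm_num
  rw [h3, abs_of_pos two_pos] at h2
  simp only [smul_eq_mul] at h
  linarith

lemma half_sq_smul (hF : IsMinkowskiNorm F) (c : ℝ) (ξ : EuclideanSpace ℝ (Fin n)) :
    F (c • ξ) ^ 2 / 2 = c ^ 2 * (F ξ ^ 2 / 2) := by
  rw [hF.homog, mul_pow, sq_abs]; ring

lemma fderiv_half_sq_smul (hF : IsMinkowskiNorm F) {c : ℝ} (hc : c ≠ 0)
    (ξ : EuclideanSpace ℝ (Fin n)) :
    fderiv ℝ (fun η => F η ^ 2 / 2) (c • ξ) = c • fderiv ℝ (fun η => F η ^ 2 / 2) ξ := by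
  have h1 := fderiv_comp_smul (f := fun η => F η ^ 2 / 2) (x := ξ) c
  have h2 : (fun η => F (c • η) ^ 2 / 2) = c ^ 2 • fun η => F η ^ 2 / 2 := by
    funext η; simp [hF.half_sq_smul]
  rw [h2, fderiv_const_smul_field, Pi.smul_apply] at h1
  have h3 : c • (c • fderiv ℝ (fun η => F η ^ 2 / 2) ξ) =
      c • fderiv ℝ (fun η => F η ^ 2 / 2) (c • ξ) := by
    rw [← h1, smul_smul, sq]
  exact (smul_right_injective _ hc h3).symm

lemma aCoeff_smul (hF : IsMinkowskiNorm F) {c : ℝ} (hc : c ≠ 0) (i j : Fin n)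
    (ξ : EuclideanSpace ℝ (Fin n)) : aCoeff F i j (c • ξ) = aCoeff F i j ξ := by
  have h1 := fderiv_comp_smul (f := pd (fun η => F η ^ 2 / 2) i) (x := ξ) c
  have h2 : (fun η => pd (fun η => F η ^ 2 / 2) i (c • η)) =
      c • pd (fun η => F η ^ 2 / 2) i := by
    funext η; simp [pd, hF.fderiv_half_sq_smul hc]
  rw [h2, fderiv_const_smul_field, Pi.smul_apply] at h1
  have h3 := smul_right_injective _ hc h1
  simp only [aCoeff]
  rw [pd, pd, h3]

end IsMinkowskiNorm

namespace IsStronglyConvexMinkowskiNormC3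

variable {n : ℕ} {F : EuclideanSpace ℝ (Fin n) → ℝ} {ξ : EuclideanSpace ℝ (Fin n)}

lemma contDiffAt (hF : IsStronglyConvexMinkowskiNormC3 F) (hξ : ξ ≠ 0) : ContDiffAt ℝ 3 F ξ :=
  hF.contDiff3.contDiffAt (isOpen_compl_singleton.mem_nhds hξ)

lemma contDiffAt_half_sq (hF : IsStronglyConvexMinkowskiNormC3 F) (hξ : ξ ≠ 0) :
    ContDiffAt ℝ 2 (fun η => F η ^ 2 / 2) ξ :=
  (((hF.contDiffAt hξ).pow 2).div_const 2).of_le (by norm_num)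

/-- A nonzero covector has a dual vector of unit dual norm. -/
lemma exists_dual (hF : IsStronglyConvexMinkowskiNormC3 F) (hξ : ξ ≠ 0) :
    ∃ z : EuclideanSpace ℝ (Fin n), inner ℝ ξ z = F ξ ∧ ∀ η, inner ℝ η z ≤ F η := by
  have hd : DifferentiableAt ℝ F ξ := (hF.contDiffAt hξ).differentiableAt (by norm_num)
  refine ⟨gradient F ξ, ?_, fun η => ?_⟩
  · rw [inner_gradient_right, conj_trivial]
    simpa using fderiv_apply_self_of_homog hd (k := 1)
      fun c hc => by rw [hF.homog, abs_of_pos hc]; simp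
  · rw [inner_gradient_right, conj_trivial]
    have h1 : HasDerivAt (fun t : ℝ => F (ξ + t • η) - t * F η) (fderiv ℝ F ξ η - F η) 0 := by
      have := hd.hasFDerivAt.hasLineDerivAt η
      refine HasDerivAt.sub this ?_
      simpa using (hasDerivAt_id (0 : ℝ)).mul_const (F η)
    have h2 := h1.nonpos_of_eventually_right_le (by
      filter_upwards [self_mem_nhdsWithin] with t ht
      have := hF.add_le ξ (t • η)
      rw [hF.homog, abs_of_pos ht] at this
      simp only [zero_smul, add_zero, zero_mul, sub_zero]
      linarith)
    linarith

lemma sum_aCoeff_self (hF : IsStronglyConvexMinkowskiNormC3 F) (hξ : ξ ≠ 0) :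
    ∑ i, ∑ j, aCoeff F i j ξ * ξ i * ξ j = F ξ ^ 2 := by
  have h := hF.contDiffAt_half_sq hξ
  simp only [aCoeff]
  rw [sum_pd_pd_eq h.differentiableAt_fderiv_of_two,
    fderiv_apply_self_of_homog h.differentiableAt_fderiv_of_two (k := 1)
      fun c hc => by rw [hF.fderiv_half_sq_smul hc.ne', pow_one]]
  simp only [Nat.cast_one, one_smul]
  rw [fderiv_apply_self_of_homog (h.differentiableAt (by norm_num)) (k := 2)
      fun c hc => hF.half_sq_smul c ξ]
  simp only [Nat.cast_ofNat, smul_eq_mul]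
  ring

/-- The coefficient matrix is a sum of rank-one squares. -/
lemma exists_aCoeff_eq_sum (hF : IsStronglyConvexMinkowskiNormC3 F) (hξ : ξ ≠ 0) :
    ∃ W : Fin n → EuclideanSpace ℝ (Fin n), ∀ i j, aCoeff F i j ξ = ∑ k, W k i * W k j := by
  have h := hF.contDiffAt_half_sq hξ
  have hsymm : IsSymmSndFDerivAt ℝ (fun η => F η ^ 2 / 2) ξ := h.isSymmSndFDerivAt (by simp)
  have hA : (Matrix.of fun i j => aCoeff F i j ξ).PosSemidef := by
    refine .of_dotProduct_mulVec_nonneg ?_ fun x => ?_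
    · ext i j
      simp only [Matrix.conjTranspose_apply, Matrix.of_apply, star_trivial, aCoeff,
        pd_pd_eq h.differentiableAt_fderiv_of_two]
      exact hsymm _ _
    · have hx : star x ⬝ᵥ (Matrix.of fun i j => aCoeff F i j ξ).mulVec x =
          ∑ i, ∑ j, aCoeff F i j ξ * x i * x j := by
        simp only [dotProduct, Matrix.mulVec, Finset.mul_sum, Matrix.of_apply, star_trivial]
        exact Finset.sum_congr rfl fun i _ => Finset.sum_congr rfl fun j _ => by ring
      rw [hx]
      by_cases h0 : x = 0
      · simp [h0]
      · exact (hF.posDef ξ hξ (WithLp.toLp 2 x) (by simpa using h0)).le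
  obtain ⟨B, hB⟩ := by
    open scoped MatrixOrder in
    exact CStarAlgebra.nonneg_iff_eq_star_mul_self.mp hA.nonneg
  refine ⟨fun k => WithLp.toLp 2 (B k), fun i j => ?_⟩
  have := congrFun (congrFun hB i) j
  simpa [Matrix.mul_apply, Matrix.star_eq_conjTranspose] using this

end IsStronglyConvexMinkowskiNormC3

section Arcsin

variable {β s : ℝ}

lemma sq_sub_sq_pos_of_abs_lt (hs : |s| < β) : 0 < β ^ 2 - s ^ 2 :=
  sub_pos.2 (sq_lt_sq' (abs_lt.1 hs).1 (abs_lt.1 hs).2)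

lemma hasDerivAt_arcsin_div (hs : |s| < β) :
    HasDerivAt (fun s => arcsin (s / β)) (√(β ^ 2 - s ^ 2))⁻¹ s := by
  have hβ : 0 < β := (abs_nonneg s).trans_lt hs
  obtain ⟨h1, h2⟩ := abs_lt.1 hs
  have h3 : -1 < s / β := by rw [lt_div_iff₀ hβ]; linarith
  have h4 : s / β < 1 := by rw [div_lt_one hβ]; exact h2
  have h5 := (Real.hasDerivAt_arcsin h3.ne' h4.ne).comp s ((hasDerivAt_id s).div_const β)
  refine h5.congr_deriv ?_
  have h6 : β ^ 2 - s ^ 2 = β ^ 2 * (1 - (s / β) ^ 2) := by field_simp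
  rw [h6, Real.sqrt_mul (sq_nonneg β), Real.sqrt_sq hβ.le]
  rw [mul_inv, one_div]
  ring

lemma hasDerivAt_inv_sqrt_sq_sub (hs : |s| < β) :
    HasDerivAt (fun s => (√(β ^ 2 - s ^ 2))⁻¹) (s * (√(β ^ 2 - s ^ 2))⁻¹ ^ 3) s := by
  have hp := sq_sub_sq_pos_of_abs_lt hs
  have hq : 0 < √(β ^ 2 - s ^ 2) := Real.sqrt_pos.2 hp
  have h1 : HasDerivAt (fun s : ℝ => β ^ 2 - s ^ 2) (-(2 * s)) s := by
    simpa using (hasDerivAt_pow 2 s).const_sub (β ^ 2)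
  refine ((h1.sqrt hp.ne').inv hq.ne').congr_deriv ?_
  field_simp

end Arcsin

/-- Second-order expansion of `arcsin (u / β)` along a line. -/
lemma hasDerivAt_arcsin_comp_line {E : Type*} [NormedAddCommGroup E] [NormedSpace ℝ E]
    {u : E → ℝ} {x : E} {β : ℝ} (hu : ContDiffAt ℝ 2 u x) (hx : |u x| < β) (w : E) :
    ∃ e₁ : ℝ → ℝ,
      (∀ᶠ t in 𝓝 (0 : ℝ), HasDerivAt (fun t => arcsin (u (x + t • w) / β)) (e₁ t) t) ∧
      HasDerivAt e₁ (u x * (√(β ^ 2 - u x ^ 2))⁻¹ ^ 3 * fderiv ℝ u x w ^ 2 +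
        (√(β ^ 2 - u x ^ 2))⁻¹ * fderiv ℝ (fderiv ℝ u) x w w) 0 := by
  have hline (t : ℝ) : HasDerivAt (fun t : ℝ => x + t • w) w t := by
    simpa using ((hasDerivAt_id t).smul_const w).const_add x
  have htend : Tendsto (fun t : ℝ => x + t • w) (𝓝 0) (𝓝 x) := by
    simpa using (hline 0).continuousAt.tendsto
  have hdiff : ∀ᶠ y in 𝓝 x, DifferentiableAt ℝ u y :=
    (hu.eventually (by simp)).mono fun y hy => hy.differentiableAt (by norm_num)
  have hlt : ∀ᶠ y in 𝓝 x, |u y| < β := hu.continuousAt.abs.eventually_lt_const hx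
  have hcomp : ∀ {t : ℝ}, DifferentiableAt ℝ u (x + t • w) →
      HasDerivAt (fun t : ℝ => u (x + t • w)) (fderiv ℝ u (x + t • w) w) t := fun {t} ht =>
    ht.hasFDerivAt.comp_hasDerivAt t (hline t)
  refine ⟨fun t => (√(β ^ 2 - u (x + t • w) ^ 2))⁻¹ * fderiv ℝ u (x + t • w) w, ?_, ?_⟩
  · filter_upwards [htend.eventually hdiff, htend.eventually hlt] with t h1 h2
    exact (hasDerivAt_arcsin_div h2).comp t (hcomp h1)
  · have h0 : x + (0 : ℝ) • w = x := by simp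
    have h1 := hcomp (t := 0) (by rw [h0]; exact hdiff.self_of_nhds)
    have h2 := (hasDerivAt_inv_sqrt_sq_sub (s := u (x + (0 : ℝ) • w)) (by rwa [h0])).comp
      (0 : ℝ) h1
    have h3 : HasDerivAt (fun t : ℝ => fderiv ℝ u (x + t • w)) (fderiv ℝ (fderiv ℝ u) x w) 0 := by
      have : HasFDerivAt (fderiv ℝ u) (fderiv ℝ (fderiv ℝ u) x) (x + (0 : ℝ) • w) := by
        rw [h0]; exact hu.differentiableAt_fderiv_of_two.hasFDerivAt
      exact this.comp_hasDerivAt (0 : ℝ) (hline 0)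
    have h4 := h2.mul (h3.clm_apply (hasDerivAt_const (0 : ℝ) w))
    refine h4.congr_deriv ?_
    simp only [h0, map_zero, add_zero, Function.comp_apply]
    ring

/-- Away from critical points, the Finsler Laplacian of `arcsin (u / β)` for a solution of
`Qu = -λu` is the trace of its second derivatives along a square root `W` of the
coefficient matrix. -/
lemma sum_second_deriv_arcsin {n : ℕ} {F u : EuclideanSpace ℝ (Fin n) → ℝ}
    {x ξ : EuclideanSpace ℝ (Fin n)} {lam c : ℝ} (hF : IsStronglyConvexMinkowskiNormC3 F)
    (hu : ContDiffAt ℝ 2 u x) (hξ : ξ ≠ 0) (hc : c ≠ 0) (hcξ : c • gradient u x = ξ)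
    (heq : ∑ i, ∑ j, aCoeff F i j (gradient u x) * pd (pd u i) j x = -lam * u x)
    {W : Fin n → EuclideanSpace ℝ (Fin n)} (hW : ∀ i j, aCoeff F i j ξ = ∑ k, W k i * W k j) :
    ∑ k, (u x * c ^ 3 * fderiv ℝ u x (W k) ^ 2 + c * fderiv ℝ (fderiv ℝ u) x (W k) (W k)) =
      c * u x * (F ξ ^ 2 - lam) := by
  have h1 : ∑ k, fderiv ℝ (fderiv ℝ u) x (W k) (W k) = -lam * u x := by
    simp only [← heq, ← sum_pd_pd_eq hu.differentiableAt_fderiv_of_two]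
    rw [Finset.sum_comm]
    refine Finset.sum_congr rfl fun i _ => ?_
    rw [Finset.sum_comm]
    refine Finset.sum_congr rfl fun j _ => ?_
    rw [← hF.aCoeff_smul hc, hcξ, hW, Finset.sum_mul]
    exact Finset.sum_congr rfl fun k _ => by ring
  have h2 : ∑ k, (c * fderiv ℝ u x (W k)) ^ 2 = F ξ ^ 2 := by
    rw [← hF.sum_aCoeff_self hξ]
    have h3 (k : Fin n) : c * fderiv ℝ u x (W k) = ∑ i, ξ i * W k i := by
      rw [← hcξ, ← inner_gradient_left, ← real_inner_smul_left, PiLp.inner_apply]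
      simp [mul_comm]
    simp only [h3, hW, sq, Finset.sum_mul, Finset.mul_sum]
    rw [Finset.sum_comm]
    refine Finset.sum_congr rfl fun i _ => ?_
    rw [Finset.sum_comm]
    exact Finset.sum_congr rfl fun j _ => Finset.sum_congr rfl fun k _ => by ring
  calc _ = c * u x * ∑ k, (c * fderiv ℝ u x (W k)) ^ 2 +
        c * ∑ k, fderiv ℝ (fderiv ℝ u) x (W k) (W k) := by
        rw [Finset.mul_sum, Finset.mul_sum, ← Finset.sum_add_distrib]
        exact Finset.sum_congr rfl fun k _ => by ring
    _ = _ := by rw [h1, h2]; ring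

/-- A segment that leaves an open set meets its frontier. -/
lemma IsOpen.exists_sub_smul_mem_frontier {E : Type*} [NormedAddCommGroup E] [NormedSpace ℝ E]
    {Ω : Set E} (hop : IsOpen Ω) {y z : E} {t : ℝ} (ht : 0 ≤ t) (hy : y ∈ Ω)
    (hyt : y - t • z ∉ Ω) : ∃ s ∈ Icc 0 t, y - s • z ∈ frontier Ω := by
  by_contra! h
  have hpre : IsPreconnected ((fun s : ℝ => y - s • z) '' Icc 0 t) :=
    isPreconnected_Icc.image _ (by fun_prop)
  refine hyt (hpre.subset_of_closure_inter_subset hop ⟨y, ⟨0, ⟨le_rfl, ht⟩, by simp⟩, hy⟩ ?_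
    ⟨t, ⟨ht, le_rfl⟩, rfl⟩)
  rintro _ ⟨hcl, s, hs, rfl⟩
  by_contra hn
  exact h s hs (by rw [hop.frontier_eq]; exact ⟨hcl, hn⟩)

section TwoPoint

variable {n : ℕ} {Ω : Set (EuclideanSpace ℝ (Fin n))} {F u : EuclideanSpace ℝ (Fin n) → ℝ}
  {lam β L : ℝ} {x y ξ z : EuclideanSpace ℝ (Fin n)}

lemma contDiffAt_two_of_gradient_ne_zero (hop : IsOpen Ω) (hu1 : ContDiffOn ℝ 1 u Ω)
    (hu2 : ContDiffOn ℝ 2 u {x ∈ Ω | gradient u x ≠ 0}) (hx : x ∈ Ω) (hgx : gradient u x ≠ 0) :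
    ContDiffAt ℝ 2 u x := by
  refine hu2.contDiffAt (IsOpen.mem_nhds ?_ ⟨hx, hgx⟩)
  have hgrad : ContinuousOn (gradient u) Ω :=
    (InnerProductSpace.toDual ℝ _).symm.continuous.comp_continuousOn
      (hu1.continuousOn_fderiv_of_isOpen hop le_rfl)
  exact hgrad.isOpen_inter_preimage hop isOpen_compl_singleton

lemma hasDerivAt_arcsin_comp_line_zero (hu : DifferentiableAt ℝ u x) (hx : |u x| < β)
    (w : EuclideanSpace ℝ (Fin n)) :
    HasDerivAt (fun t : ℝ => arcsin (u (x + t • w) / β))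
      (inner ℝ ((√(β ^ 2 - u x ^ 2))⁻¹ • gradient u x) w) 0 := by
  rw [real_inner_smul_left, inner_gradient_left]
  have h := hu.hasFDerivAt.hasLineDerivAt w
  have h0 : u (x + (0 : ℝ) • w) = u x := by simp
  exact (hasDerivAt_arcsin_div (by rwa [h0])).comp (0 : ℝ) h |>.congr_deriv (by rw [h0])

/-- A positive maximum of `arcsin (u (x + t z) / β) - arcsin (u x / β) - L t` cannot be attained
with both endpoints interior: there, translating both endpoints forces the Laplacians to be
ordered the wrong way. -/
lemma not_isLocalMax_arcsin_sub (hF : IsStronglyConvexMinkowskiNormC3 F)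
    (hxd : DifferentiableAt ℝ u x) (hyd : DifferentiableAt ℝ u y)
    (hx2 : gradient u x ≠ 0 → ContDiffAt ℝ 2 u x) (hy2 : gradient u y ≠ 0 → ContDiffAt ℝ 2 u y)
    (hx : |u x| < β) (hy : |u y| < β) (hux : 0 ≤ u x) (huxy : u x < u y)
    (heqx : gradient u x ≠ 0 →
      ∑ i, ∑ j, aCoeff F i j (gradient u x) * pd (pd u i) j x = -lam * u x)
    (heqy : gradient u y ≠ 0 →
      ∑ i, ∑ j, aCoeff F i j (gradient u y) * pd (pd u i) j y = -lam * u y)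
    (hξ : (√(β ^ 2 - u y ^ 2))⁻¹ • gradient u y = ξ) (hξ0 : ξ ≠ 0) (hFξ : lam < F ξ ^ 2)
    (hmax : ∀ w, IsLocalMax
      (fun t : ℝ => arcsin (u (y + t • w) / β) - arcsin (u (x + t • w) / β)) 0) : False := by
  have hcx : 0 < (√(β ^ 2 - u x ^ 2))⁻¹ := by
    have := sq_sub_sq_pos_of_abs_lt hx
    positivity
  have hcy : 0 < (√(β ^ 2 - u y ^ 2))⁻¹ := by
    have := sq_sub_sq_pos_of_abs_lt hy
    positivity
  have hξx : (√(β ^ 2 - u x ^ 2))⁻¹ • gradient u x = ξ := by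
    rw [← hξ]
    refine ext_inner_right ℝ fun w => ?_
    have := (hmax w).hasDerivAt_eq_zero ((hasDerivAt_arcsin_comp_line_zero hyd hy w).sub
      (hasDerivAt_arcsin_comp_line_zero hxd hx w))
    linarith
  have hgx : gradient u x ≠ 0 := by rintro h; rw [h, smul_zero] at hξx; exact hξ0 hξx.symm
  have hgy : gradient u y ≠ 0 := by rintro h; rw [h, smul_zero] at hξ; exact hξ0 hξ.symm
  obtain ⟨W, hW⟩ := hF.exists_aCoeff_eq_sum hξ0
  have hle := Finset.sum_le_sum fun k (_ : k ∈ Finset.univ) => by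
    obtain ⟨e, he, he'⟩ := hasDerivAt_arcsin_comp_line (hx2 hgx) hx (W k)
    obtain ⟨d, hd, hd'⟩ := hasDerivAt_arcsin_comp_line (hy2 hgy) hy (W k)
    exact sub_nonpos.1 <| (hmax (W k)).second_deriv_nonpos
      (by filter_upwards [he, hd] with t h1 h2 using h2.sub h1) (hd'.sub he')
  rw [sum_second_deriv_arcsin hF (hx2 hgx) hξ0 hcx.ne' hξx (heqx hgx) hW,
    sum_second_deriv_arcsin hF (hy2 hgy) hξ0 hcy.ne' hξ (heqy hgy) hW] at hle
  have hc : (√(β ^ 2 - u x ^ 2))⁻¹ ≤ (√(β ^ 2 - u y ^ 2))⁻¹ := by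
    have := sq_sub_sq_pos_of_abs_lt hy
    gcongr
  have hlt : (√(β ^ 2 - u x ^ 2))⁻¹ * u x < (√(β ^ 2 - u y ^ 2))⁻¹ * u y :=
    mul_lt_mul' hc huxy hux hcy
  exact absurd hle (not_le.2 (mul_lt_mul_of_pos_right hlt (sub_pos.2 hFξ)))

/-- `arcsin (u / β)` minus an affine function has no local maximum with slope above `√λ`. -/
lemma not_isLocalMax_arcsin_sub_affine (hF : IsStronglyConvexMinkowskiNormC3 F)
    (hy2 : gradient u y ≠ 0 → ContDiffAt ℝ 2 u y) (hy : |u y| < β) (huy : 0 < u y)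
    (heqy : gradient u y ≠ 0 →
      ∑ i, ∑ j, aCoeff F i j (gradient u y) * pd (pd u i) j y = -lam * u y)
    (hξ : (√(β ^ 2 - u y ^ 2))⁻¹ • gradient u y = ξ) (hξ0 : ξ ≠ 0) (hFξ : lam < F ξ ^ 2)
    (f : EuclideanSpace ℝ (Fin n) →L[ℝ] ℝ)
    (hmax : IsLocalMax (fun y => arcsin (u y / β) - f y) y) : False := by
  have hcy : 0 < (√(β ^ 2 - u y ^ 2))⁻¹ := by
    have := sq_sub_sq_pos_of_abs_lt hy
    positivity
  have hgy : gradient u y ≠ 0 := by rintro h; rw [h, smul_zero] at hξ; exact hξ0 hξ.symm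
  obtain ⟨W, hW⟩ := hF.exists_aCoeff_eq_sum hξ0
  have hle := Finset.sum_nonpos fun k (_ : k ∈ Finset.univ) => by
    obtain ⟨d, hd, hd'⟩ := hasDerivAt_arcsin_comp_line (hy2 hgy) hy (W k)
    have htend : Tendsto (fun t : ℝ => y + t • W k) (𝓝 0) (𝓝 y) := by
      have : Continuous fun t : ℝ => y + t • W k := by fun_prop
      simpa using this.tendsto 0
    have hline (t : ℝ) : HasDerivAt (fun t : ℝ => f (y + t • W k)) (f (W k)) t := by
      simpa using (((hasDerivAt_id t).mul_const (f (W k))).const_add (f y))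
    have hlm : IsLocalMax (fun t : ℝ => arcsin (u (y + t • W k) / β) - f (y + t • W k)) 0 := by
      filter_upwards [htend.eventually hmax] with t ht
      simpa using ht
    exact hlm.second_deriv_nonpos (e₁ := fun t => d t - f (W k))
      (by filter_upwards [hd] with t h using h.sub (hline t)) (hd'.sub_const _)
  rw [sum_second_deriv_arcsin hF (hy2 hgy) hξ0 hcy.ne' hξ (heqy hgy) hW] at hle
  exact absurd hle (not_le.2 (by have := sub_pos.2 hFξ; positivity))

/-- In a direction `z` of dual norm at most one, `arcsin (u / β)` is `L`-Lipschitz. -/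
lemma arcsin_sub_le (hbd : Bornology.IsBounded Ω) (hop : IsOpen Ω) (hconv : Convex ℝ Ω)
    (hF : IsStronglyConvexMinkowskiNormC3 F) (hL0 : 0 < L) (hL : lam < L ^ 2) (hβ : 1 < β)
    (hz : ∀ η, inner ℝ η z ≤ F η)
    (hu1 : ContDiffOn ℝ 1 u (closure Ω))
    (hu2 : ContDiffOn ℝ 2 u {x ∈ Ω | gradient u x ≠ 0})
    (hpos : ∀ x ∈ Ω, 0 < u x) (hzero : ∀ x ∈ frontier Ω, u x = 0) (hle : ∀ x ∈ Ω, u x ≤ 1)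
    (heqn : ∀ x ∈ Ω, gradient u x ≠ 0 →
      ∑ i, ∑ j, aCoeff F i j (gradient u x) * pd (pd u i) j x = -lam * u x)
    {t : ℝ} (ht : t ∈ Icc 0 (π / 2 / L)) (hx : x ∈ closure Ω) (hxt : x + t • z ∈ closure Ω) :
    arcsin (u (x + t • z) / β) - arcsin (u x / β) - L * t ≤ 0 := by
  have hβ0 : 0 < β := one_pos.trans hβ
  have hfr {y} (hy : y ∈ closure Ω) (hyn : y ∉ Ω) : u y = 0 :=
    hzero y (by rw [hop.frontier_eq]; exact ⟨hy, hyn⟩)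
  have hnonneg {y} (hy : y ∈ closure Ω) : 0 ≤ arcsin (u y / β) := by
    by_cases hyΩ : y ∈ Ω
    · have := hpos y hyΩ
      exact arcsin_nonneg.2 (by positivity)
    · simp [hfr hy hyΩ]
  have habs {y} (hy : y ∈ Ω) : |u y| < β := by
    rw [abs_of_pos (hpos y hy)]; exact (hle y hy).trans_lt hβ
  have hu1Ω : ContDiffOn ℝ 1 u Ω := hu1.mono subset_closure
  have hdiff {y} (hy : y ∈ Ω) : DifferentiableAt ℝ u y :=
    (hu1Ω.contDiffAt (hop.mem_nhds hy)).differentiableAt (by norm_num)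
  have hC2 {y} (hy : y ∈ Ω) := contDiffAt_two_of_gradient_ne_zero hop hu1Ω hu2 hy
  set K : Set (EuclideanSpace ℝ (Fin n) × ℝ) :=
    (closure Ω ×ˢ Icc 0 (π / 2 / L)) ∩ (fun p => p.1 + p.2 • z) ⁻¹' closure Ω
  have hKc : IsCompact K :=
    (hbd.isCompact_closure.prod isCompact_Icc).inter_right
      (isClosed_closure.preimage (by fun_prop))
  have hΦ : ContinuousOn
      (fun p : EuclideanSpace ℝ (Fin n) × ℝ =>
        arcsin (u (p.1 + p.2 • z) / β) - arcsin (u p.1 / β) - L * p.2) K := by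
    have h1 : ContinuousOn (fun p : EuclideanSpace ℝ (Fin n) × ℝ => u (p.1 + p.2 • z)) K :=
      hu1.continuousOn.comp (by fun_prop) fun p hp => hp.2
    have h2 : ContinuousOn (fun p : EuclideanSpace ℝ (Fin n) × ℝ => u p.1) K :=
      hu1.continuousOn.comp (by fun_prop) fun p hp => hp.1.1
    exact ((continuous_arcsin.comp_continuousOn (h1.div_const β)).sub
      (continuous_arcsin.comp_continuousOn (h2.div_const β))).sub (by fun_prop)
  obtain ⟨⟨x₀, t₀⟩, ⟨⟨hx₀, ht₀⟩, hy₀⟩, hmax⟩ := hKc.exists_isMaxOn ⟨(x, t), ⟨hx, ht⟩, hxt⟩ hΦ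
  have hmax' {x t} (hx : x ∈ closure Ω) (ht : t ∈ Icc 0 (π / 2 / L))
      (hxt : x + t • z ∈ closure Ω) := isMaxOn_iff.1 hmax (x, t) ⟨⟨hx, ht⟩, hxt⟩
  simp only [mem_preimage] at hx₀ ht₀ hy₀ hmax'
  refine (hmax' hx ht hxt).trans ?_
  by_contra! hM
  obtain ⟨y₀, hy₀eq⟩ : ∃ y₀, y₀ = x₀ + t₀ • z := ⟨_, rfl⟩
  simp only [← hy₀eq] at hy₀ hmax' hM
  have ht₀pos : 0 < t₀ := by
    refine lt_of_le_of_ne ht₀.1 fun h => ?_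
    have : y₀ = x₀ := by rw [hy₀eq, ← h]; simp
    rw [this, ← h] at hM
    simp at hM
  have hLt : 0 < L * t₀ := mul_pos hL0 ht₀pos
  have hy₀Ω : y₀ ∈ Ω := by
    by_contra hn
    rw [hfr hy₀ hn, zero_div, arcsin_zero] at hM
    have := hnonneg hx₀
    linarith
  obtain ⟨ξ, hξ⟩ : ∃ ξ, (√(β ^ 2 - u y₀ ^ 2))⁻¹ • gradient u y₀ = ξ := ⟨_, rfl⟩
  have hLξ : L ≤ F ξ := by
    have h1 := (hasDerivAt_arcsin_comp_line_zero (hdiff hy₀Ω) (habs hy₀Ω) (-z)).add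
      ((hasDerivAt_id (0 : ℝ)).const_mul L)
    have h2 := h1.nonpos_of_eventually_right_le (by
      have hnear : ∀ᶠ s : ℝ in 𝓝[>] 0, y₀ + s • (-z) ∈ Ω := by
        have hc : Continuous fun s : ℝ => y₀ + s • (-z) := by fun_prop
        exact nhdsWithin_le_nhds ((hc.tendsto 0).eventually (hop.mem_nhds (by simpa using hy₀Ω)))
      filter_upwards [hnear, self_mem_nhdsWithin, nhdsWithin_le_nhds (gt_mem_nhds ht₀pos)]
        with s hs hs0 hst
      have hs0' : 0 < s := hs0
      have hst' : s < t₀ := hst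
      have he : x₀ + (t₀ - s) • z = y₀ + s • (-z) := by rw [hy₀eq]; module
      have := hmax' hx₀ (t := t₀ - s) ⟨by linarith, by linarith [ht₀.2]⟩
        (by rw [he]; exact subset_closure hs)
      rw [he] at this
      simp only [Pi.add_apply, id, zero_smul, add_zero, mul_zero]
      linarith)
    rw [hξ, inner_neg_right] at h2
    linarith [hz ξ]
  have hξ0 : ξ ≠ 0 := by
    rintro rfl
    rw [hF.map_zero] at hLξ
    linarith
  have hFξ : lam < F ξ ^ 2 := hL.trans_le (by gcongr)
  by_cases hx₀Ω : x₀ ∈ Ω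
  · have hlt : u x₀ < u y₀ := by
      by_contra! h
      have : arcsin (u y₀ / β) ≤ arcsin (u x₀ / β) := monotone_arcsin (by gcongr)
      linarith
    refine not_isLocalMax_arcsin_sub hF (hdiff hx₀Ω) (hdiff hy₀Ω) (hC2 hx₀Ω) (hC2 hy₀Ω)
      (habs hx₀Ω) (habs hy₀Ω) (hpos x₀ hx₀Ω).le hlt (heqn x₀ hx₀Ω) (heqn y₀ hy₀Ω) hξ hξ0 hFξ
      fun w => ?_
    have hnear {y} (hy : y ∈ Ω) : ∀ᶠ s : ℝ in 𝓝 0, y + s • w ∈ Ω := by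
      have hc : Continuous fun s : ℝ => y + s • w := by fun_prop
      exact (hc.tendsto 0).eventually (hop.mem_nhds (by simpa using hy))
    filter_upwards [hnear hx₀Ω, hnear hy₀Ω] with s hsx hsy
    have he : x₀ + s • w + t₀ • z = y₀ + s • w := by rw [hy₀eq]; module
    have := hmax' (subset_closure hsx) ht₀ (by rw [he]; exact subset_closure hsy)
    rw [he] at this
    simp only [zero_smul, add_zero]
    linarith
  · have hvx₀ : arcsin (u x₀ / β) = 0 := by rw [hfr hx₀ hx₀Ω]; simp
    rw [hvx₀, sub_zero] at hmax' hM
    obtain ⟨f, hf⟩ := geometric_hahn_banach_open_point hconv hop hx₀Ω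
    have hfy : f y₀ = f x₀ + t₀ * f z := by rw [hy₀eq]; simp
    have hfz : f z < 0 := by
      have := hf y₀ hy₀Ω
      by_contra! h
      have := mul_nonneg ht₀pos.le h
      linarith
    have hbound (y) (hy : y ∈ Ω) :
        arcsin (u y / β) ≤ arcsin (u y₀ / β) - L * t₀ + L * ((f y - f x₀) / f z) := by
      have ht1 : 0 ≤ (f y - f x₀) / f z :=
        div_nonneg_of_nonpos (by linarith [hf y hy]) hfz.le
      obtain ⟨s, hs, hsfr⟩ := hop.exists_sub_smul_mem_frontier (z := z) ht1 hy fun hmem => by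
        have := hf _ hmem
        rw [map_sub, map_smul, smul_eq_mul, div_mul_cancel₀ _ hfz.ne] at this
        linarith
      have hsle : L * s ≤ L * ((f y - f x₀) / f z) := mul_le_mul_of_nonneg_left hs.2 hL0.le
      have he : y - s • z + s • z = y := by abel
      by_cases hsT : s ≤ π / 2 / L
      · have := hmax' (frontier_subset_closure hsfr) ⟨hs.1, hsT⟩
          (by rw [he]; exact subset_closure hy)
        rw [he, hzero _ hsfr, zero_div, arcsin_zero] at this
        linarith
      · have h1 : π / 2 < s * L := (div_lt_iff₀ hL0).1 (not_le.1 hsT)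
        linarith [arcsin_le_pi_div_two (u y / β)]
    refine not_isLocalMax_arcsin_sub_affine hF (hC2 hy₀Ω) (habs hy₀Ω) (hpos y₀ hy₀Ω)
      (heqn y₀ hy₀Ω) hξ hξ0 hFξ ((L / f z) • f) ?_
    filter_upwards [hop.mem_nhds hy₀Ω] with y hy
    have h1 := hbound y hy
    have h2 : L * ((f y - f x₀) / f z) = L / f z * f y - L / f z * f y₀ + L * t₀ := by
      have := hfz.ne
      rw [hfy]
      field_simp
      ring
    simp only [FunLike.coe_smul, Pi.smul_apply, smul_eq_mul]
    linarith

/-- Directional form of the gradient estimate in the interior. -/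
lemma fderiv_apply_le (hbd : Bornology.IsBounded Ω) (hop : IsOpen Ω) (hconv : Convex ℝ Ω)
    (hF : IsStronglyConvexMinkowskiNormC3 F) (hlam : 0 < lam)
    (hz : ∀ η, inner ℝ η z ≤ F η)
    (hu1 : ContDiffOn ℝ 1 u (closure Ω))
    (hu2 : ContDiffOn ℝ 2 u {x ∈ Ω | gradient u x ≠ 0})
    (hpos : ∀ x ∈ Ω, 0 < u x) (hzero : ∀ x ∈ frontier Ω, u x = 0) (hle : ∀ x ∈ Ω, u x ≤ 1)
    (heqn : ∀ x ∈ Ω, gradient u x ≠ 0 →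
      ∑ i, ∑ j, aCoeff F i j (gradient u x) * pd (pd u i) j x = -lam * u x)
    (hx : x ∈ Ω) : fderiv ℝ u x z ≤ √lam * √(1 - u x ^ 2) := by
  have hlim : Tendsto (fun ε : ℝ => (√lam + ε) * √((1 + ε) ^ 2 - u x ^ 2)) (𝓝[>] 0)
      (𝓝 (√lam * √(1 - u x ^ 2))) := by
    have hc : Continuous fun ε : ℝ => (√lam + ε) * √((1 + ε) ^ 2 - u x ^ 2) := by fun_prop
    simpa using (hc.tendsto 0).mono_left nhdsWithin_le_nhds
  refine ge_of_tendsto hlim ?_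
  filter_upwards [self_mem_nhdsWithin] with ε hε
  have hε : 0 < ε := hε
  have hsq : 0 ≤ √lam := Real.sqrt_nonneg _
  have hL0 : 0 < √lam + ε := by positivity
  have hL : lam < (√lam + ε) ^ 2 := by nlinarith [Real.sq_sqrt hlam.le]
  have habs : |u x| < 1 + ε := by
    rw [abs_of_pos (hpos x hx)]; linarith [hle x hx]
  have hdiff : DifferentiableAt ℝ u x :=
    (hu1.contDiffAt (mem_of_superset (hop.mem_nhds hx) subset_closure)).differentiableAt
      (by norm_num)
  have h1 := (hasDerivAt_arcsin_comp_line_zero hdiff habs z).sub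
    ((hasDerivAt_id (0 : ℝ)).const_mul (√lam + ε))
  have h2 := h1.nonpos_of_eventually_right_le (by
    have hnear : ∀ᶠ s : ℝ in 𝓝[>] 0, x + s • z ∈ Ω := by
      have hc : Continuous fun s : ℝ => x + s • z := by fun_prop
      exact nhdsWithin_le_nhds ((hc.tendsto 0).eventually (hop.mem_nhds (by simpa using hx)))
    have hT : 0 < π / 2 / (√lam + ε) := by positivity
    filter_upwards [hnear, self_mem_nhdsWithin, nhdsWithin_le_nhds (gt_mem_nhds hT)]
      with s hs hs0 hsT
    have := arcsin_sub_le hbd hop hconv hF hL0 hL (by linarith : 1 < 1 + ε) hz hu1 hu2 hpos hzero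
      hle heqn ⟨le_of_lt hs0, le_of_lt hsT⟩ (subset_closure hx) (subset_closure hs)
    simp only [Pi.sub_apply, id, zero_smul, add_zero, mul_zero, sub_zero]
    linarith)
  have hroot : 0 < √((1 + ε) ^ 2 - u x ^ 2) := Real.sqrt_pos.2 (sq_sub_sq_pos_of_abs_lt habs)
  rw [real_inner_smul_left, inner_gradient_left, mul_one, sub_nonpos,
    inv_mul_le_iff₀ hroot] at h2
  linarith

end TwoPoint

/-- Li–Yau-type gradient estimate for the first Dirichlet eigenfunction of the
Finsler–Laplacian: `F(∇u)² ≤ λ((α+1)² − (α+u)²)` for every `α > 0`, and hence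
`F(∇u)² ≤ λ(1 − u²)`. -/
theorem dirichlet_gradient_estimate {n : ℕ} (hn : 1 ≤ n)
    (Ω : Set (EuclideanSpace ℝ (Fin n))) (hne : Ω.Nonempty)
    (hbd : Bornology.IsBounded Ω) (hop : IsOpen Ω) (hconv : Convex ℝ Ω)
    (hsb : HasSmoothBoundary Ω)
    (F : EuclideanSpace ℝ (Fin n) → ℝ) (hF : IsStronglyConvexMinkowskiNormC3 F)
    (lam : ℝ) (hlam : 0 < lam)
    (u : EuclideanSpace ℝ (Fin n) → ℝ)
    (hu1 : ContDiffOn ℝ 1 u (closure Ω))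
    (hu2 : ContDiffOn ℝ 2 u {x ∈ Ω | gradient u x ≠ 0})
    (hpos : ∀ x ∈ Ω, 0 < u x)
    (hzero : ∀ x ∈ frontier Ω, u x = 0)
    (hsup : IsLUB (u '' Ω) 1)
    (heqn : ∀ x ∈ Ω, gradient u x ≠ 0 →
      ∑ i, ∑ j, aCoeff F i j (gradient u x) * pd (pd u i) j x = -lam * u x) :
    (∀ α : ℝ, 0 < α → ∀ x ∈ closure Ω,
      F (gradient u x) ^ 2 ≤ lam * ((α + 1) ^ 2 - (α + u x) ^ 2)) ∧
    (∀ x ∈ closure Ω, F (gradient u x) ^ 2 ≤ lam * (1 - u x ^ 2)) := by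
  have hcl {x} (hx : x ∈ closure Ω) : 0 ≤ u x ∧ u x ≤ 1 := by
    by_cases hxΩ : x ∈ Ω
    · exact ⟨(hpos x hxΩ).le, hsup.1 ⟨x, hxΩ, rfl⟩⟩
    · rw [hzero x (by rw [hop.frontier_eq]; exact ⟨hx, hxΩ⟩)]
      norm_num
  have hle : ∀ x ∈ Ω, u x ≤ 1 := fun x hx => hsup.1 ⟨x, hx, rfl⟩
  have huniq : UniqueDiffOn ℝ (closure Ω) :=
    uniqueDiffOn_convex hconv.closure
      (hne.mono (hop.subset_interior_iff.2 subset_closure))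
  have hmain : ∀ x ∈ closure Ω, F (gradient u x) ^ 2 ≤ lam * (1 - u x ^ 2) := by
    intro x hx
    have hrad : 0 ≤ 1 - u x ^ 2 := by nlinarith [hcl hx]
    by_cases hg : gradient u x = 0
    · rw [hg, hF.map_zero]
      simpa using mul_nonneg hlam.le hrad
    have hd : DifferentiableAt ℝ u x := by
      by_contra h
      exact hg (gradient_eq_zero_of_not_differentiableAt h)
    obtain ⟨z, hgz, hz⟩ := hF.exists_dual hg
    have hbound : ∀ y ∈ closure Ω,
        fderivWithin ℝ u (closure Ω) y z ≤ √lam * √(1 - u y ^ 2) := by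
      have hc : ContinuousOn (fun y => fderivWithin ℝ u (closure Ω) y z) (closure Ω) :=
        (hu1.continuousOn_fderivWithin huniq le_rfl).clm_apply continuousOn_const
      have hr : ContinuousOn (fun y => √lam * √(1 - u y ^ 2)) (closure Ω) :=
        continuousOn_const.mul (continuousOn_const.sub (hu1.continuousOn.pow 2)).sqrt
      intro y hy
      refine ContinuousWithinAt.closure_le hy ((hc y hy).mono subset_closure)
        ((hr y hy).mono subset_closure) fun w hw => ?_
      rw [fderivWithin_of_mem_nhds (mem_of_superset (hop.mem_nhds hw) subset_closure)]
      exact fderiv_apply_le hbd hop hconv hF hlam hz hu1 hu2 hpos hzero hle heqn hw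
    have h1 := hbound x hx
    rw [hd.fderivWithin (huniq x hx), ← inner_gradient_left, hgz] at h1
    calc F (gradient u x) ^ 2 ≤ (√lam * √(1 - u x ^ 2)) ^ 2 := by
          gcongr; exact hF.nonneg _
      _ = lam * (1 - u x ^ 2) := by rw [mul_pow, Real.sq_sqrt hlam.le, Real.sq_sqrt hrad]
  refine ⟨fun α hα x hx => (hmain x hx).trans ?_, hmain⟩
  exact mul_le_mul_of_nonneg_left (by nlinarith [hcl hx]) hlam.le
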